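/- arXiv:1312.2516 — 4 statements merged into one kernel-verified Lean document; each statement's English description precedes it below -/
import Mathlib

section
/- Let f : ℝⁿ → [0,∞] be any nonnegative function (not necessarily convex). Then its polar Pf belongs to Cvx₀(ℝⁿ), and Pf is given explicitly by: Pf(y) = sup over x with f(x) ≠ 0 of (⟨x,y⟩ − 1)/f(x) whenever 0 ≠ y lies in the polar set (f⁻¹(0))°; Pf(0) = 0; and Pf(y) = +∞ whenever y ∉ (f⁻¹(0))°. -/
open scoped ENNReal RealInnerProductSpace
open Set

noncomputable section

/-- Euclidean space `ℝⁿ`. -/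
abbrev Euc (n : ℕ) := EuclideanSpace ℝ (Fin n)

/-- The polarity transform `𝒫`:
`(Pf)(y) = inf {c ≥ 0 : ⟨x,y⟩ ≤ 1 + c·f(x) for all x}`, with `inf ∅ = ∞`.
(Nonnegativity of `c` is automatic since we work in `ℝ≥0∞`.) -/
def polarT {n : ℕ} (f : Euc n → ℝ≥0∞) (y : Euc n) : ℝ≥0∞ :=
  sInf {c : ℝ≥0∞ | ∀ x : Euc n, ENNReal.ofReal ⟪x, y⟫ ≤ 1 + c * f x}

/-- The class `Cvx₀(ℝⁿ)` of geometric convex functions: lower semicontinuous, convex,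
nonnegative (automatic), vanishing at the origin. -/
def GeomConvexOn {n : ℕ} (f : Euc n → ℝ≥0∞) : Prop :=
  (∀ x y : Euc n, ∀ a b : ℝ, 0 ≤ a → 0 ≤ b → a + b = 1 →
    f (a • x + b • y) ≤ ENNReal.ofReal a * f x + ENNReal.ofReal b * f y) ∧
  LowerSemicontinuous f ∧ f 0 = 0

/-- The polar set `K° = {y : ⟨x,y⟩ ≤ 1 ∀ x ∈ K}`. -/
def polarSet {n : ℕ} (K : Set (Euc n)) : Set (Euc n) :=
  {y : Euc n | ∀ x ∈ K, ⟪x, y⟫ ≤ 1}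

/-- The Legendre transform `(Lf)(y) = sup_x (⟨x,y⟩ - f(x))` of a `[0,∞]`-valued function,
with values in `[0,∞]` (for `f` with `f(0) = 0` the supremum is automatically `≥ 0`,
so the `ℝ≥0∞`-valued truncated subtraction computes the genuine Legendre transform). -/
def legendreT {n : ℕ} (f : Euc n → ℝ≥0∞) (y : Euc n) : ℝ≥0∞ :=
  ⨆ x : Euc n, ENNReal.ofReal ⟪x, y⟫ - f x

/-- The usual subdifferential `∂g(x) = {y : g(z) ≥ g(x) + ⟨z - x, y⟩ ∀ z}`,
stated in `EReal` to accommodate `[0,∞]`-valued functions. -/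
def subdiff {n : ℕ} (g : Euc n → ℝ≥0∞) (x : Euc n) : Set (Euc n) :=
  {y : Euc n | ∀ z : Euc n, (g x : EReal) + ((⟪z - x, y⟫ : ℝ) : EReal) ≤ (g z : EReal)}

/-- The polar subdifferential `∂°f(x) = {y ∈ dom(Pf) : Pf(y)·f(x) = ⟨x,y⟩ - 1}`. -/
def polarSubdiff {n : ℕ} (f : Euc n → ℝ≥0∞) (x : Euc n) : Set (Euc n) :=
  {y : Euc n | polarT f y ≠ ∞ ∧
    (polarT f y : EReal) * (f x : EReal) = ((⟪x, y⟫ - 1 : ℝ) : EReal)}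

/-- `g` restricted to the segment `[0,x]` is linear (i.e. `g(t•x) = c·t` for `t ∈ [0,1]`). -/
def RayLinear {n : ℕ} (g : Euc n → ℝ≥0∞) (x : Euc n) : Prop :=
  ∃ c : ℝ, 0 ≤ c ∧ ∀ t : ℝ, t ∈ Icc (0:ℝ) 1 → g (t • x) = ENNReal.ofReal (c * t)

/-- `g` is not linear on `[0,x+]`: there is no `t > 1` such that `g` is linear on `[0,t•x]`. -/
def NotLinearPlus {n : ℕ} (g : Euc n → ℝ≥0∞) (x : Euc n) : Prop :=
  ¬ ∃ t : ℝ, 1 < t ∧ RayLinear g (t • x)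

/-- `f` is nonlinear at infinity: for every ray `ℝ⁺x`, `t ↦ f(tx)` is finite everywhere and
is not squeezed between `at - b` and `at` for any `a ≥ 0`, `b > 0`. -/
def NonlinearAtInfinity {n : ℕ} (f : Euc n → ℝ≥0∞) : Prop :=
  ∀ x : Euc n, x ≠ 0 →
    (∀ t : ℝ, 0 ≤ t → f (t • x) ≠ ∞) ∧
    ¬ ∃ a b : ℝ, 0 ≤ a ∧ 0 < b ∧ ∀ t : ℝ, 0 ≤ t →
        ENNReal.ofReal (a * t - b) ≤ f (t • x) ∧ f (t • x) ≤ ENNReal.ofReal (a * t)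

/-- The class `S₁(ℝⁿ)`: geometric convex functions which are finite-valued, continuously
differentiable off the origin, and strictly convex. -/
def S1 {n : ℕ} (f : Euc n → ℝ≥0∞) : Prop :=
  GeomConvexOn f ∧ (∀ x, f x ≠ ∞) ∧
  ContDiffOn ℝ 1 (fun x => (f x).toReal) ({0}ᶜ : Set (Euc n)) ∧
  StrictConvexOn ℝ (univ : Set (Euc n)) (fun x => (f x).toReal)

/-- The Hessian of a real-valued function, as the derivative of the gradient map. -/
def hess {n : ℕ} (g : Euc n → ℝ) (x : Euc n) : Euc n →L[ℝ] Euc n :=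
  fderiv ℝ (fun z => gradient g z) x

/-- The class `S₂(ℝⁿ)`: geometric convex functions which are finite-valued, strictly convex,
twice continuously differentiable off the origin with positive definite Hessian there. -/
def S2 {n : ℕ} (f : Euc n → ℝ≥0∞) : Prop :=
  GeomConvexOn f ∧ (∀ x, f x ≠ ∞) ∧
  StrictConvexOn ℝ (univ : Set (Euc n)) (fun x => (f x).toReal) ∧
  ContDiffOn ℝ 2 (fun x => (f x).toReal) ({0}ᶜ : Set (Euc n)) ∧
  ∀ x : Euc n, x ≠ 0 → ∀ v : Euc n, v ≠ 0 →
    0 < ⟪v, hess (fun z => (f z).toReal) x v⟫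

theorem polarT_eq_iSup {n : ℕ} (f : Euc n → ℝ≥0∞) (y : Euc n) :
    polarT f y = ⨆ x : Euc n, ENNReal.ofReal (⟪x, y⟫ - 1) / f x := by
  have key : ∀ (x : Euc n) (c : ℝ≥0∞),
      ENNReal.ofReal ⟪x, y⟫ ≤ 1 + c ↔ ENNReal.ofReal (⟪x, y⟫ - 1) ≤ c := by
    intro x c
    rw [ENNReal.ofReal_sub _ zero_le_one, ENNReal.ofReal_one, tsub_le_iff_left]
  apply le_antisymm
  · refine le_of_forall_gt fun c hc => ?_
    obtain ⟨d, hd, hdc⟩ := exists_between hc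
    suffices h : d ∈ {c : ℝ≥0∞ | ∀ x : Euc n, ENNReal.ofReal ⟪x, y⟫ ≤ 1 + c * f x} from
      (sInf_le h).trans_lt hdc
    refine fun x => (key x _).2 ?_
    have hx := (le_iSup (fun x : Euc n => ENNReal.ofReal (⟪x, y⟫ - 1) / f x) x).trans hd.le
    exact (ENNReal.div_le_iff_le_mul (Or.inr hdc.ne_top) (Or.inr (bot_lt_of_lt hd).ne')).1 hx
  · refine iSup_le fun x => le_sInf fun c hc => ENNReal.div_le_of_le_mul ?_
    exact (key x _).1 (hc x)

theorem Continuous.lowerSemicontinuous_ennreal_mul_const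
    {X : Type*} [TopologicalSpace X] {g : X → ℝ≥0∞}
    (hg : Continuous g) (k : ℝ≥0∞) : LowerSemicontinuous fun x => g x * k := by
  by_cases hk : k = ∞
  · have h : (fun x => g x * k) = fun x => ⨆ m : ℕ, g x * m := by
      funext x
      rw [hk, ← ENNReal.iSup_natCast, ENNReal.mul_iSup]
    rw [h]
    exact lowerSemicontinuous_iSup fun m =>
      ((ENNReal.continuous_mul_const (ENNReal.natCast_ne_top m)).comp hg).lowerSemicontinuous
  · exact ((ENNReal.continuous_mul_const hk).comp hg).lowerSemicontinuous

theorem lowerSemicontinuous_polarT {n : ℕ} (f : Euc n → ℝ≥0∞) :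
    LowerSemicontinuous (polarT f) := by
  rw [funext (polarT_eq_iSup f)]
  refine lowerSemicontinuous_iSup fun x => ?_
  simp only [div_eq_mul_inv]
  exact Continuous.lowerSemicontinuous_ennreal_mul_const (ENNReal.continuous_ofReal.comp (by fun_prop)) _

theorem polarT_convex {n : ℕ} (f : Euc n → ℝ≥0∞) (y z : Euc n) {a b : ℝ} (ha : 0 ≤ a)
    (hb : 0 ≤ b) (hab : a + b = 1) :
    polarT f (a • y + b • z) ≤
      ENNReal.ofReal a * polarT f y + ENNReal.ofReal b * polarT f z := by
  simp only [polarT_eq_iSup]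
  refine iSup_le fun x => ?_
  have h : ENNReal.ofReal (⟪x, a • y + b • z⟫ - 1) ≤
      ENNReal.ofReal a * ENNReal.ofReal (⟪x, y⟫ - 1) +
        ENNReal.ofReal b * ENNReal.ofReal (⟪x, z⟫ - 1) := by
    rw [← ENNReal.ofReal_mul ha, ← ENNReal.ofReal_mul hb, inner_add_right, inner_smul_right,
      inner_smul_right]
    refine le_trans (le_of_eq ?_) ENNReal.ofReal_add_le
    congr 1
    linear_combination hab
  refine (ENNReal.div_le_div_right h _).trans ?_
  rw [ENNReal.add_div, mul_div_assoc, mul_div_assoc]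
  gcongr
  · exact le_iSup (fun x : Euc n => ENNReal.ofReal (⟪x, y⟫ - 1) / f x) x
  · exact le_iSup (fun x : Euc n => ENNReal.ofReal (⟪x, z⟫ - 1) / f x) x

theorem polarT_zero {n : ℕ} (f : Euc n → ℝ≥0∞) : polarT f 0 = 0 := by
  simp [polarT_eq_iSup]

theorem polarT_eq_top {n : ℕ} (f : Euc n → ℝ≥0∞) {y : Euc n}
    (hy : y ∉ polarSet {x : Euc n | f x = 0}) : polarT f y = ∞ := by
  simp only [polarSet, mem_ofPred_eq, not_forall, not_le] at hy
  obtain ⟨x, hx, hxy⟩ := hy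
  rw [polarT_eq_iSup, eq_top_iff]
  refine le_trans (le_of_eq ?_) (le_iSup _ x)
  rw [hx, ENNReal.div_zero]
  simpa using hxy

theorem coe_polarT_eq_iSup {n : ℕ} (f : Euc n → ℝ≥0∞) {y : Euc n} (hy0 : y ≠ 0)
    (hy : y ∈ polarSet {x : Euc n | f x = 0}) :
    (polarT f y : EReal) =
      ⨆ x ∈ {x : Euc n | f x ≠ 0},
        ((⟪x, y⟫ - 1 : ℝ) : EReal) * (((f x)⁻¹ : ℝ≥0∞) : EReal) := by
  set S : EReal := ⨆ x ∈ {x : Euc n | f x ≠ 0},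
    ((⟪x, y⟫ - 1 : ℝ) : EReal) * (((f x)⁻¹ : ℝ≥0∞) : EReal) with hS
  have hle : ∀ x : Euc n, f x ≠ 0 →
      ((⟪x, y⟫ - 1 : ℝ) : EReal) * (((f x)⁻¹ : ℝ≥0∞) : EReal) ≤ S := fun x hx =>
    le_iSup₂_of_le x hx le_rfl
  have hpos : ∀ x : Euc n, 1 < ⟪x, y⟫ → f x ≠ 0 := fun x hx h0 => (hy x h0).not_gt hx
  have hS0 : 0 ≤ S := by
    have hyy : ⟪(2 / ⟪y, y⟫ : ℝ) • y, y⟫ = (2 : ℝ) := by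
      rw [real_inner_smul_left]
      exact div_mul_cancel₀ _ (inner_self_ne_zero.2 hy0)
    refine le_trans ?_ (hle _ (hpos ((2 / ⟪y, y⟫ : ℝ) • y) (by rw [hyy]; norm_num)))
    refine mul_nonneg ?_ (EReal.coe_ennreal_nonneg _)
    rw [hyy]
    exact EReal.coe_nonneg.2 (by norm_num)
  apply le_antisymm
  · rw [← EReal.coe_toENNReal hS0, EReal.coe_ennreal_le_coe_ennreal_iff, polarT_eq_iSup]
    refine iSup_le fun x => ?_
    rcases le_or_gt ⟪x, y⟫ (1 : ℝ) with h | h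
    · simp [ENNReal.ofReal_of_nonpos (sub_nonpos.2 h)]
    · rw [← EReal.coe_ennreal_le_coe_ennreal_iff, EReal.coe_toENNReal hS0, div_eq_mul_inv,
        EReal.coe_ennreal_mul, EReal.coe_ennreal_ofReal, max_eq_left (sub_pos.2 h).le]
      exact hle x (hpos x h)
  · refine iSup₂_le fun x _ => ?_
    rw [polarT_eq_iSup]
    refine le_trans ?_ (EReal.coe_ennreal_le_coe_ennreal_iff.2 (le_iSup _ x))
    rw [div_eq_mul_inv, EReal.coe_ennreal_mul, EReal.coe_ennreal_ofReal]
    exact mul_le_mul_of_nonneg_right (EReal.coe_le_coe_iff.2 (le_max_left _ _))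
      (EReal.coe_ennreal_nonneg _)

/-- Lemma 2.1 (i): for any nonnegative `f`, `Pf ∈ Cvx₀(ℝⁿ)` and `Pf` is given by the
explicit sup formula. -/
theorem stmt_0 {n : ℕ} (f : Euc n → ℝ≥0∞) :
    GeomConvexOn (polarT f) ∧
    polarT f 0 = 0 ∧
    (∀ y : Euc n, y ≠ 0 → y ∈ polarSet {x : Euc n | f x = 0} →
      (polarT f y : EReal) =
        ⨆ x ∈ {x : Euc n | f x ≠ 0},
          ((⟪x, y⟫ - 1 : ℝ) : EReal) * (((f x)⁻¹ : ℝ≥0∞) : EReal)) ∧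
    (∀ y : Euc n, y ∉ polarSet {x : Euc n | f x = 0} → polarT f y = ∞) := by
  exact ⟨⟨fun y z _ _ ha hb hab => polarT_convex f y z ha hb hab, lowerSemicontinuous_polarT f,
    polarT_zero f⟩, polarT_zero f, fun _ hy0 hy => coe_polarT_eq_iSup f hy0 hy,
    fun _ hy => polarT_eq_top f hy⟩
end
end

section
/- Let f ∈ Cvx₀(ℝⁿ). Then the closure of the domain of Pf equals the polar set of the zero set of f, and the closure of the domain of f equals the polar set of the zero set of Pf: closure(dom(Pf)) = ({x : f(x) = 0})° and closure(dom(f)) = ({y : Pf(y) = 0})°. -/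
open scoped ENNReal RealInnerProductSpace
open Set

noncomputable section

/-- A point outside a closed convex set containing the origin is strictly separated from it by a
continuous linear functional at level `1`. -/
theorem exists_clm_lt_one_of_notMem {E : Type*} [NormedAddCommGroup E] [NormedSpace ℝ E]
    {K : Set E} (hc : Convex ℝ K) (hK : IsClosed K) (h0 : (0 : E) ∈ K) {p : E} (hp : p ∉ K) :
    ∃ φ : E →L[ℝ] ℝ, (∀ x ∈ K, φ x < 1) ∧ 1 < φ p := by
  obtain ⟨φ, u, h1, h2⟩ := geometric_hahn_banach_closed_point hc hK hp
  have hu : 0 < u := by simpa using h1 0 h0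
  refine ⟨u⁻¹ • φ, fun x hx => ?_, ?_⟩
  · simpa [inv_mul_lt_iff₀ hu] using h1 x hx
  · simpa [lt_inv_mul_iff₀ hu] using h2

theorem exists_inner_eq {n : ℕ} (φ : Euc n →L[ℝ] ℝ) : ∃ y : Euc n, ∀ x, φ x = ⟪x, y⟫ :=
  ⟨(InnerProductSpace.toDual ℝ (Euc n)).symm φ, fun x => by
    rw [real_inner_comm, InnerProductSpace.toDual_symm_apply]⟩

theorem isClosed_polarSet {n : ℕ} (K : Set (Euc n)) : IsClosed (polarSet K) := by
  simp only [polarSet, ofPred_forall]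
  exact isClosed_biInter fun x _ => isClosed_le (by fun_prop) continuous_const

theorem polarT_le_ofReal {n : ℕ} {f : Euc n → ℝ≥0∞} {y : Euc n} {c : ℝ} (hc : 0 < c)
    (h : ∀ x, f x ≠ ∞ → ⟪x, y⟫ ≤ 1 + c * (f x).toReal) : polarT f y ≤ ENNReal.ofReal c := by
  refine sInf_le fun x => ?_
  by_cases hx : f x = ∞
  · simp [hx, hc]
  · calc ENNReal.ofReal ⟪x, y⟫ ≤ ENNReal.ofReal (1 + c * (f x).toReal) :=
          ENNReal.ofReal_le_ofReal (h x hx)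
      _ = 1 + ENNReal.ofReal c * f x := by
          rw [ENNReal.ofReal_add zero_le_one (by positivity), ENNReal.ofReal_mul hc.le,
            ENNReal.ofReal_toReal hx, ENNReal.ofReal_one]

theorem inner_le_of_polarT_lt {n : ℕ} {f : Euc n → ℝ≥0∞} {y : Euc n} {c : ℝ} (hc : 0 < c)
    (h : polarT f y < ENNReal.ofReal c) {x : Euc n} (hx : f x ≠ ∞) :
    ⟪x, y⟫ ≤ 1 + c * (f x).toReal := by
  obtain ⟨d, hd, hdc⟩ := sInf_lt_iff.1 h
  have key : ENNReal.ofReal ⟪x, y⟫ ≤ ENNReal.ofReal (1 + c * (f x).toReal) :=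
    calc ENNReal.ofReal ⟪x, y⟫ ≤ 1 + d * f x := hd x
      _ ≤ 1 + ENNReal.ofReal c * f x := by gcongr
      _ = _ := by
          rw [ENNReal.ofReal_add zero_le_one (by positivity), ENNReal.ofReal_mul hc.le,
            ENNReal.ofReal_toReal hx, ENNReal.ofReal_one]
  exact (ENNReal.ofReal_le_ofReal_iff (by positivity)).1 key

theorem polarT_ne_top_iff {n : ℕ} {f : Euc n → ℝ≥0∞} {y : Euc n} :
    polarT f y ≠ ∞ ↔ ∃ c : ℝ, 0 < c ∧ ∀ x, f x ≠ ∞ → ⟪x, y⟫ ≤ 1 + c * (f x).toReal := by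
  constructor
  · intro h
    have hc : 0 < (polarT f y).toReal + 1 := by positivity
    refine ⟨(polarT f y).toReal + 1, hc, fun x hx => inner_le_of_polarT_lt hc ?_ hx⟩
    rw [ENNReal.lt_ofReal_iff_toReal_lt h]
    exact lt_add_one _
  · rintro ⟨c, hc, h⟩
    exact ((polarT_le_ofReal hc h).trans_lt ENNReal.ofReal_lt_top).ne

theorem polarT_eq_zero_iff {n : ℕ} {f : Euc n → ℝ≥0∞} {y : Euc n} :
    polarT f y = 0 ↔ ∀ x, f x ≠ ∞ → ⟪x, y⟫ ≤ 1 := by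
  constructor
  · intro h x hx
    refine le_of_forall_pos_le_add fun ε hε => ?_
    have hm : 0 < (f x).toReal + 1 := by positivity
    have hc : 0 < ε / ((f x).toReal + 1) := by positivity
    have := inner_le_of_polarT_lt hc (by rw [h]; exact ENNReal.ofReal_pos.2 hc) hx
    have h2 : ε / ((f x).toReal + 1) * (f x).toReal ≤ ε := by
      rw [div_mul_eq_mul_div, div_le_iff₀ hm]
      nlinarith
    linarith
  · intro h
    refine le_antisymm (ENNReal.le_of_forall_pos_le_add fun ε hε _ => ?_) zero_le
    have hε' : (0 : ℝ) < ε := hε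
    have := polarT_le_ofReal (f := f) hε' fun x hx =>
      (h x hx).trans (le_add_of_nonneg_right (by positivity))
    simpa using this

theorem convex_polarT_ne_top {n : ℕ} (f : Euc n → ℝ≥0∞) :
    Convex ℝ {y : Euc n | polarT f y ≠ ∞} := by
  intro y hy z hz a b ha hb hab
  simp only [mem_ofPred_eq, polarT_ne_top_iff] at hy hz ⊢
  obtain ⟨c, hc, h⟩ := hy
  obtain ⟨d, hd, h'⟩ := hz
  refine ⟨c + d, by positivity, fun x hx => ?_⟩
  have hm : 0 ≤ (f x).toReal := ENNReal.toReal_nonneg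
  rw [inner_add_right, inner_smul_right, inner_smul_right]
  have h1 : ⟪x, y⟫ ≤ 1 + (c + d) * (f x).toReal := by nlinarith [h x hx]
  have h2 : ⟪x, z⟫ ≤ 1 + (c + d) * (f x).toReal := by nlinarith [h' x hx]
  calc a * ⟪x, y⟫ + b * ⟪x, z⟫
      ≤ a * (1 + (c + d) * (f x).toReal) + b * (1 + (c + d) * (f x).toReal) := by gcongr
    _ = 1 + (c + d) * (f x).toReal := by rw [← add_mul, hab, one_mul]

theorem GeomConvexOn.convex_ne_top {n : ℕ} {f : Euc n → ℝ≥0∞} (hf : GeomConvexOn f) :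
    Convex ℝ {x : Euc n | f x ≠ ∞} := by
  intro x hx y hy a b ha hb hab
  refine ((hf.1 x y a b ha hb hab).trans_lt ?_).ne
  exact ENNReal.add_lt_top.2 ⟨ENNReal.mul_lt_top ENNReal.ofReal_lt_top (Ne.lt_top hx),
    ENNReal.mul_lt_top ENNReal.ofReal_lt_top (Ne.lt_top hy)⟩

/-- The epigraph of a geometric convex function is convex. -/
theorem GeomConvexOn.convex_epigraph {n : ℕ} {f : Euc n → ℝ≥0∞} (hf : GeomConvexOn f) :
    Convex ℝ {p : Euc n × ℝ | 0 ≤ p.2 ∧ f p.1 ≤ ENNReal.ofReal p.2} := by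
  rintro ⟨x, s⟩ ⟨hs, hx⟩ ⟨y, t⟩ ⟨ht, hy⟩ a b ha hb hab
  dsimp only at hs hx ht hy
  refine ⟨add_nonneg (mul_nonneg ha hs) (mul_nonneg hb ht), (hf.1 x y a b ha hb hab).trans ?_⟩
  simp only [Prod.snd_add, Prod.smul_snd, smul_eq_mul]
  rw [ENNReal.ofReal_add (by positivity) (by positivity), ENNReal.ofReal_mul ha,
    ENNReal.ofReal_mul hb]
  gcongr

/-- The epigraph of a geometric convex function is closed. -/
theorem GeomConvexOn.isClosed_epigraph {n : ℕ} {f : Euc n → ℝ≥0∞} (hf : GeomConvexOn f) :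
    IsClosed {p : Euc n × ℝ | 0 ≤ p.2 ∧ f p.1 ≤ ENNReal.ofReal p.2} := by
  refine (isClosed_le continuous_const continuous_snd).inter ?_
  exact hf.2.1.isClosed_epigraph.preimage
    (continuous_fst.prodMk (ENNReal.continuous_ofReal.comp continuous_snd))

/-- Points where `f` is positive are separated from the zero set by the domain of `polarT f`. -/
theorem GeomConvexOn.exists_one_lt_inner {n : ℕ} {f : Euc n → ℝ≥0∞} (hf : GeomConvexOn f)
    {p : Euc n} (hp : f p ≠ 0) : ∃ y, polarT f y ≠ ∞ ∧ 1 < ⟪p, y⟫ := by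
  obtain ⟨φ, h1, h2⟩ := exists_clm_lt_one_of_notMem hf.convex_epigraph hf.isClosed_epigraph
    (by simp [hf.2.2]) (p := (p, (0 : ℝ))) (by simpa using hp)
  obtain ⟨y, hy⟩ := exists_inner_eq (φ.comp (ContinuousLinearMap.inl ℝ (Euc n) ℝ))
  have hφ (x : Euc n) (t : ℝ) : φ (x, t) = ⟪x, y⟫ + t * φ (0, 1) := by
    rw [← hy, ← smul_eq_mul, ← map_smul]
    simp [← map_add]
  refine ⟨y, polarT_ne_top_iff.2 ⟨|φ (0, 1)| + 1, by positivity, fun x hx => ?_⟩, ?_⟩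
  · have h := h1 (x, (f x).toReal) ⟨ENNReal.toReal_nonneg, (ENNReal.ofReal_toReal hx).ge⟩
    rw [hφ] at h
    nlinarith [neg_abs_le (φ (0, 1)), ENNReal.toReal_nonneg (a := f x)]
  · rwa [hφ, zero_mul, add_zero] at h2

/-- Equation (2.5): for `f ∈ Cvx₀(ℝⁿ)`, `closure (dom Pf) = {f = 0}°` and
`closure (dom f) = {Pf = 0}°`. -/
theorem stmt_3 {n : ℕ} (f : Euc n → ℝ≥0∞) (hf : GeomConvexOn f) :
    closure {y : Euc n | polarT f y ≠ ∞} = polarSet {x : Euc n | f x = 0} ∧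
    closure {x : Euc n | f x ≠ ∞} = polarSet {y : Euc n | polarT f y = 0} := by
  refine ⟨Subset.antisymm (closure_minimal ?_ (isClosed_polarSet _)) ?_,
    Subset.antisymm (closure_minimal ?_ (isClosed_polarSet _)) ?_⟩
  · intro y hy x hx
    obtain ⟨c, -, h⟩ := polarT_ne_top_iff.1 hy
    have hfx : f x = 0 := hx
    simpa [hfx] using h x (by simp [hfx])
  · intro y hy
    by_contra hy'
    obtain ⟨φ, h1, h2⟩ := exists_clm_lt_one_of_notMem (convex_polarT_ne_top f).closure
      isClosed_closure (subset_closure (polarT_ne_top_iff.2 ⟨1, one_pos, fun x _ => by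
        rw [inner_zero_right]; positivity⟩)) hy'
    obtain ⟨p, hp⟩ := exists_inner_eq φ
    rw [hp, real_inner_comm] at h2
    refine h2.not_ge (hy p ?_)
    by_contra hfp
    obtain ⟨z, hz, hpz⟩ := hf.exists_one_lt_inner hfp
    have := h1 z (subset_closure hz)
    rw [hp, real_inner_comm] at this
    exact lt_asymm this hpz
  · intro x hx y hy
    rw [real_inner_comm]
    exact polarT_eq_zero_iff.1 hy x hx
  · intro x hx
    by_contra hx'
    obtain ⟨φ, h1, h2⟩ := exists_clm_lt_one_of_notMem hf.convex_ne_top.closure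
      isClosed_closure (subset_closure (by simp [hf.2.2])) hx'
    obtain ⟨y, hy⟩ := exists_inner_eq φ
    rw [hy, real_inner_comm] at h2
    refine h2.not_ge (hx y (polarT_eq_zero_iff.2 fun z hz => ?_))
    rw [← hy]
    exact (h1 z (subset_closure hz)).le
end
end

section
/- Let f ∈ Cvx₀(ℝⁿ) and x ∈ int(dom(f)) with f(x) ≠ 0. (a) If f is differentiable at x, then either ∂°f(x) = ∅ or ∂°f(x) = {y} with y = ∇f(x)/Lf(∇f(x)), and in the latter case Pf(y) = 1/Lf(∇f(x)) = 1/(⟨x, ∇f(x)⟩ − f(x)). (b) Conversely, if ∂°f(x) = {y} is a singleton, then the subdifferential ∂f(x) = {y/Pf(y)}; in particular f is differentiable at x and y = ∇f(x)/Lf(∇f(x)). -/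
open scoped ENNReal RealInnerProductSpace
open Set

noncomputable section

section
open Filter Topology

variable {E : Type*} [NormedAddCommGroup E] [InnerProductSpace ℝ E]

/-- A subgradient on a neighbourhood is a subgradient on the whole domain. -/
lemma ConvexOn.subgradient_of_eventually {s : Set E} {F : E → ℝ} (hF : ConvexOn ℝ s F)
    {x p : E} (hx : x ∈ s) (hp : ∀ᶠ z in 𝓝 x, F x + ⟪p, z - x⟫ ≤ F z) :
    ∀ z ∈ s, F x + ⟪p, z - x⟫ ≤ F z := by
  have hconv : ConvexOn ℝ s (fun z => F z - ⟪p, z⟫) :=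
    hF.sub ((innerSL ℝ p).toLinearMap.concaveOn hF.1)
  have hmin : IsMinOn (fun z => F z - ⟪p, z⟫) s x := by
    refine IsMinOn.of_isLocalMinOn_of_convexOn hx ?_ hconv
    refine Filter.Eventually.filter_mono nhdsWithin_le_nhds ?_
    filter_upwards [hp] with z hz
    rw [inner_sub_right] at hz
    linarith
  intro z hz
  have := hmin hz
  simp only [mem_ofPred_eq] at this
  rw [inner_sub_right]
  linarith

/-- Subgradients are bounded by a local Lipschitz constant. -/
lemma norm_le_of_subgradient_of_lipschitzOnWith {F : E → ℝ} {K : NNReal} {t : Set E} {w p : E}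
    (hF : LipschitzOnWith K F t) (ht : t ∈ 𝓝 w) (hp : ∀ z ∈ t, F w + ⟪p, z - w⟫ ≤ F z) :
    ‖p‖ ≤ K := by
  have hev : ∀ᶠ r : ℝ in 𝓝[>] 0, w + r • p ∈ t := by
    have : Tendsto (fun r : ℝ => w + r • p) (𝓝 0) (𝓝 w) := by
      have : Continuous (fun r : ℝ => w + r • p) := by fun_prop
      simpa using this.tendsto 0
    exact (this.mono_left nhdsWithin_le_nhds).eventually ht
  obtain ⟨r, hrt, hr⟩ := (hev.and self_mem_nhdsWithin).exists
  replace hr : 0 < r := hr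
  have h₁ := hp _ hrt
  have h₂ := hF.dist_le_mul _ hrt _ (mem_of_mem_nhds ht)
  rw [Real.dist_eq, dist_eq_norm, add_sub_cancel_left, norm_smul, Real.norm_of_nonneg hr.le] at h₂
  rw [add_sub_cancel_left, real_inner_smul_right, real_inner_self_eq_norm_sq] at h₁
  have h₃ : r * ‖p‖ * ‖p‖ ≤ r * ‖p‖ * K := by nlinarith [le_abs_self (F (w + r • p) - F w)]
  rcases (norm_nonneg p).eq_or_lt with h | h
  · rw [← h]; exact K.2
  · exact le_of_mul_le_mul_left h₃ (mul_pos hr h)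

variable [FiniteDimensional ℝ E]

/-- A convex function on an open set has a subgradient at every point of that set. -/
lemma ConvexOn.exists_subgradient_of_isOpen {s : Set E} {F : E → ℝ} (hF : ConvexOn ℝ s F)
    (hs : IsOpen s) {w : E} (hw : w ∈ s) : ∃ p : E, ∀ z ∈ s, F w + ⟪p, z - w⟫ ≤ F z := by
  have hcont := hF.continuousOn hs
  have hopen : IsOpen {q : E × ℝ | q.1 ∈ s ∧ F q.1 < q.2} := by
    rw [isOpen_iff_mem_nhds]
    rintro ⟨z, t⟩ ⟨hz, ht⟩
    have hFz : Tendsto (fun q : E × ℝ => F q.1) (𝓝 (z, t)) (𝓝 (F z)) :=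
      (hcont.continuousAt (hs.mem_nhds hz)).tendsto.comp (continuous_fst.tendsto (z, t))
    filter_upwards [(continuous_fst.tendsto (z, t)).eventually (hs.mem_nhds hz),
      hFz.eventually_lt (continuous_snd.tendsto (z, t)) ht] with q h₁ h₂
    exact ⟨h₁, h₂⟩
  obtain ⟨φ, hφ⟩ := geometric_hahn_banach_open_point (x := ((w, F w) : E × ℝ))
    hF.convex_strict_epigraph hopen (fun h => lt_irrefl _ h.2)
  have hsplit : ∀ (z : E) (t : ℝ), φ (z, t) = φ (z, 0) + t * φ (0, 1) := by
    intro z t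
    have : ((z, t) : E × ℝ) = (z, 0) + t • (0, 1) := by simp
    rw [this, map_add, map_smul, smul_eq_mul]
  set b := φ (0, 1) with hb
  have hneg : b < 0 := by
    have h := hφ (w, F w + 1) ⟨hw, by simp⟩
    rw [hsplit w (F w + 1), hsplit w (F w)] at h
    linarith
  let ξ : E →L[ℝ] ℝ := φ.comp (ContinuousLinearMap.inl ℝ E ℝ)
  refine ⟨(-b)⁻¹ • (InnerProductSpace.toDual ℝ E).symm ξ, fun z hz => ?_⟩
  have hle : φ (z, 0) - φ (w, 0) ≤ (-b) * (F z - F w) := by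
    refine le_of_forall_pos_le_add fun ε hε => ?_
    have hlt : F z < F z + ε / (-b) := by
      have : 0 < ε / (-b) := div_pos hε (by linarith)
      linarith
    have h := hφ (z, F z + ε / (-b)) ⟨hz, hlt⟩
    rw [hsplit z _, hsplit w (F w)] at h
    have : ε / (-b) * b = -ε := by rw [div_neg, neg_mul, div_mul_cancel₀ _ hneg.ne]
    nlinarith
  have hξ : ξ (z - w) = φ (z, 0) - φ (w, 0) := by
    rw [map_sub]; rfl
  rw [real_inner_smul_left, InnerProductSpace.toDual_symm_apply, hξ]
  have : (-b)⁻¹ * (φ (z, 0) - φ (w, 0)) ≤ F z - F w := by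
    rw [inv_mul_le_iff₀ (by linarith)]; exact hle
  linarith

/-- A convex function with a unique subgradient at an interior point of its domain is
differentiable there. -/
lemma ConvexOn.hasGradientAt_of_unique_subgradient {s : Set E} {F : E → ℝ} (hF : ConvexOn ℝ s F)
    {x g : E} (hx : x ∈ interior s)
    (huniq : ∀ p : E, (∀ z ∈ s, F x + ⟪p, z - x⟫ ≤ F z) → p = g) : HasGradientAt F g x := by
  have hFi : ConvexOn ℝ (interior s) F := hF.subset interior_subset hF.1.interior
  have hcont : ContinuousAt F x :=
    (hFi.continuousOn isOpen_interior).continuousAt (isOpen_interior.mem_nhds hx)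
  have hsub : ∀ w : E, ∃ p : E, w ∈ interior s → ∀ z ∈ interior s, F w + ⟪p, z - w⟫ ≤ F z := by
    intro w
    by_cases hw : w ∈ interior s
    · obtain ⟨p, hp⟩ := hFi.exists_subgradient_of_isOpen isOpen_interior hw
      exact ⟨p, fun _ => hp⟩
    · exact ⟨0, fun h => absurd h hw⟩
  choose G hG using hsub
  have hmem : ∀ᶠ w in 𝓝 x, w ∈ interior s := isOpen_interior.mem_nhds hx
  have hgx : G x = g := huniq _ (hF.subgradient_of_eventually (interior_subset hx)
    (hmem.mono fun z hz => hG x hx z hz))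
  obtain ⟨K, t, ht, hK⟩ := hFi.locallyLipschitzOn isOpen_interior hx
  rw [isOpen_interior.nhdsWithin_eq hx] at ht
  have hbound : ∀ᶠ w in 𝓝 x, G w ∈ Metric.closedBall (0 : E) K := by
    filter_upwards [eventually_mem_nhds_iff.2 ht, eventually_mem_nhds_iff.2 hmem] with w hw hws
    rw [mem_closedBall_zero_iff]
    exact norm_le_of_subgradient_of_lipschitzOnWith (hK.mono inter_subset_left)
      (inter_mem hw hws) fun z hz => hG w (mem_of_mem_nhds hws) z hz.2
  have hlim : Tendsto G (𝓝 x) (𝓝 g) := by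
    refine (isCompact_closedBall (0 : E) K).tendsto_nhds_of_unique_mapClusterPt hbound ?_
    intro p _ hp
    obtain ⟨U, hU, hUp⟩ := mapClusterPt_iff_ultrafilter.1 hp
    refine huniq p (hF.subgradient_of_eventually (interior_subset hx) (hmem.mono fun z hz => ?_))
    have hUx : Tendsto (fun w => z - w) U (𝓝 (z - x)) := tendsto_const_nhds.sub hU
    exact le_of_tendsto ((hcont.tendsto.mono_left hU).add (hUp.inner hUx))
      ((hmem.filter_mono hU).mono fun w hw => hG w hw z hz)
  rw [hasGradientAt_iff_isLittleO, Asymptotics.isLittleO_iff]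
  intro c hc
  filter_upwards [hmem, hlim.eventually (Metric.closedBall_mem_nhds g hc)] with w hw hwc
  have h₁ := hG x hx w hw
  have h₂ := hG w hw x hx
  rw [hgx] at h₁
  have h₃ : ⟪G w - g, w - x⟫ ≤ c * ‖w - x‖ :=
    (real_inner_le_norm _ _).trans (by
      gcongr
      rwa [← dist_eq_norm])
  rw [← neg_sub w x, inner_neg_right] at h₂
  rw [inner_sub_left] at h₃
  rw [Real.norm_eq_abs, abs_le]
  constructor <;> nlinarith [norm_nonneg (w - x), mul_nonneg hc.le (norm_nonneg (w - x))]

end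

section
open Filter Topology

variable {n : ℕ} {f : Euc n → ℝ≥0∞} {x : Euc n}

lemma GeomConvexOn.convexOn_toReal (hf : GeomConvexOn f) :
    ConvexOn ℝ {z : Euc n | f z ≠ ∞} (fun z => (f z).toReal) := by
  have hfin : ∀ u v : Euc n, f u ≠ ∞ → f v ≠ ∞ → ∀ a b : ℝ,
      ENNReal.ofReal a * f u + ENNReal.ofReal b * f v ≠ ∞ := fun u v hu hv a b =>
    ENNReal.add_ne_top.2 ⟨ENNReal.mul_ne_top ENNReal.ofReal_ne_top hu,
      ENNReal.mul_ne_top ENNReal.ofReal_ne_top hv⟩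
  refine ⟨fun u hu v hv a b ha hb hab => ?_, fun u hu v hv a b ha hb hab => ?_⟩
  · exact ne_top_of_le_ne_top (hfin u v hu hv a b) (hf.1 u v a b ha hb hab)
  · have h := ENNReal.toReal_mono (hfin u v hu hv a b) (hf.1 u v a b ha hb hab)
    rw [ENNReal.toReal_add (ENNReal.mul_ne_top ENNReal.ofReal_ne_top hu)
      (ENNReal.mul_ne_top ENNReal.ofReal_ne_top hv), ENNReal.toReal_mul, ENNReal.toReal_mul,
      ENNReal.toReal_ofReal ha, ENNReal.toReal_ofReal hb] at h
    simpa using h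

lemma mem_subdiff_iff (hx : f x ≠ ∞) {p : Euc n} :
    p ∈ subdiff f x ↔ ∀ z ∈ {z : Euc n | f z ≠ ∞}, (f x).toReal + ⟪p, z - x⟫ ≤ (f z).toReal := by
  refine forall_congr' fun z => ?_
  by_cases hz : f z = ∞
  · simp [hz]
  · rw [real_inner_comm, ← EReal.coe_ennreal_toReal hx, ← EReal.coe_ennreal_toReal hz,
      ← EReal.coe_add, EReal.coe_le_coe_iff]
    exact ⟨fun h _ => h, fun h => h hz⟩

lemma inner_le_one_add_polarT_mul {y z : Euc n} (hy : polarT f y ≠ ∞) (hz : f z ≠ ∞) :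
    ⟪z, y⟫ ≤ 1 + (polarT f y).toReal * (f z).toReal := by
  have hclosed : IsClosed {c : ℝ≥0∞ | ENNReal.ofReal ⟪z, y⟫ ≤ 1 + c * f z} :=
    isClosed_le continuous_const (continuous_const.add (ENNReal.continuous_mul_const hz))
  have hne : {c : ℝ≥0∞ | ∀ u : Euc n, ENNReal.ofReal ⟪u, y⟫ ≤ 1 + c * f u}.Nonempty := by
    by_contra h
    rw [not_nonempty_iff_eq_empty] at h
    exact hy (by rw [polarT, h, sInf_empty])
  have hmem : polarT f y ∈ {c : ℝ≥0∞ | ENNReal.ofReal ⟪z, y⟫ ≤ 1 + c * f z} :=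
    closure_minimal
      (fun c (hc : ∀ u : Euc n, ENNReal.ofReal ⟪u, y⟫ ≤ 1 + c * f u) => hc z) hclosed
      (csInf_mem_closure hne (OrderBot.bddBelow _))
  have hfin : polarT f y * f z ≠ ∞ := ENNReal.mul_ne_top hy hz
  have h := (ENNReal.ofReal_le_iff_le_toReal (ENNReal.add_ne_top.2 ⟨ENNReal.one_ne_top, hfin⟩)).1
    hmem
  rwa [ENNReal.toReal_add ENNReal.one_ne_top hfin, ENNReal.toReal_mul, ENNReal.toReal_one] at h

lemma polarT_eq_ofReal {y : Euc n} {c : ℝ} (hc : 0 < c) (hx : f x ≠ ∞) (hfx : f x ≠ 0)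
    (hle : ∀ z, f z ≠ ∞ → ⟪z, y⟫ ≤ 1 + c * (f z).toReal)
    (heq : ⟪x, y⟫ = 1 + c * (f x).toReal) : polarT f y = ENNReal.ofReal c := by
  have hpos : 0 < (f x).toReal := ENNReal.toReal_pos hfx hx
  apply le_antisymm
  · refine sInf_le fun z => ?_
    by_cases hz : f z = ∞
    · simp [hz, ENNReal.mul_top, hc]
    · have h := ENNReal.ofReal_le_ofReal (hle z hz)
      rwa [ENNReal.ofReal_add zero_le_one (by positivity), ENNReal.ofReal_mul hc.le,
        ENNReal.ofReal_toReal hz, ENNReal.ofReal_one] at h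
  · refine le_sInf fun d hd => ?_
    by_cases hdt : d = ∞
    · simp [hdt]
    have hfin : d * f x ≠ ∞ := ENNReal.mul_ne_top hdt hx
    have h := (ENNReal.ofReal_le_iff_le_toReal
      (ENNReal.add_ne_top.2 ⟨ENNReal.one_ne_top, hfin⟩)).1 (hd x)
    rw [ENNReal.toReal_add ENNReal.one_ne_top hfin, ENNReal.toReal_mul, ENNReal.toReal_one,
      heq] at h
    rw [ENNReal.ofReal_le_iff_le_toReal hdt]
    exact le_of_mul_le_mul_right (by linarith) hpos

lemma mem_polarSubdiff_iff (hx : f x ≠ ∞) {y : Euc n} :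
    y ∈ polarSubdiff f x ↔
      polarT f y ≠ ∞ ∧ (polarT f y).toReal * (f x).toReal = ⟪x, y⟫ - 1 := by
  refine and_congr_right fun hy => ?_
  rw [← EReal.coe_ennreal_toReal hx, ← EReal.coe_ennreal_toReal hy, ← EReal.coe_mul,
    EReal.coe_eq_coe_iff]

/-- The Fenchel equality case: at a subgradient `p` the Legendre transform is attained at `x`. -/
lemma legendreT_of_mem_subdiff (hx : f x ≠ ∞) {p : Euc n} (hp : p ∈ subdiff f x) :
    legendreT f p = ENNReal.ofReal (⟪x, p⟫ - (f x).toReal) := by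
  rw [mem_subdiff_iff hx] at hp
  have hsub : ∀ z, f z ≠ ∞ →
      ENNReal.ofReal ⟪z, p⟫ - f z = ENNReal.ofReal (⟪z, p⟫ - (f z).toReal) := fun z hz => by
    rw [ENNReal.ofReal_sub _ ENNReal.toReal_nonneg, ENNReal.ofReal_toReal hz]
  apply le_antisymm
  · refine iSup_le fun z => ?_
    by_cases hz : f z = ∞
    · simp [hz]
    · rw [hsub z hz]
      refine ENNReal.ofReal_le_ofReal ?_
      have h := hp z hz
      rw [inner_sub_right, real_inner_comm, real_inner_comm x p] at h
      linarith
  · rw [← hsub x hx]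
    exact le_iSup (fun z => ENNReal.ofReal ⟪z, p⟫ - f z) x

lemma inner_sub_nonneg_of_mem_subdiff (hf0 : f 0 = 0) (hx : f x ≠ ∞) {p : Euc n}
    (hp : p ∈ subdiff f x) : 0 ≤ ⟪x, p⟫ - (f x).toReal := by
  have h := (mem_subdiff_iff hx).1 hp 0 (by simp [hf0])
  simp only [zero_sub, inner_neg_right, hf0, ENNReal.toReal_zero] at h
  rw [real_inner_comm]
  linarith

lemma smul_mem_polarSubdiff (hx : f x ≠ ∞) (hfx : f x ≠ 0) {p : Euc n} (hp : p ∈ subdiff f x)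
    (hpos : 0 < ⟪x, p⟫ - (f x).toReal) :
    (⟪x, p⟫ - (f x).toReal)⁻¹ • p ∈ polarSubdiff f x := by
  rw [mem_subdiff_iff hx] at hp
  set l := ⟪x, p⟫ - (f x).toReal with hl
  have heq : ⟪x, l⁻¹ • p⟫ = 1 + l⁻¹ * (f x).toReal := by
    rw [real_inner_smul_right, show ⟪x, p⟫ = l + (f x).toReal by rw [hl]; ring]
    field_simp
  have hpolar : polarT f (l⁻¹ • p) = ENNReal.ofReal l⁻¹ := by
    refine polarT_eq_ofReal (inv_pos.2 hpos) hx hfx (fun z hz => ?_) heq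
    have h := hp z hz
    rw [inner_sub_right, real_inner_comm, real_inner_comm x p] at h
    rw [real_inner_smul_right, ← inv_mul_cancel₀ hpos.ne', ← mul_add]
    gcongr
    linarith
  rw [mem_polarSubdiff_iff hx, hpolar, ENNReal.toReal_ofReal (inv_pos.2 hpos).le, heq]
  exact ⟨ENNReal.ofReal_ne_top, by ring⟩

/-- Every polar subgradient at an interior point is a normalized subgradient. -/
lemma exists_subgradient_of_mem_polarSubdiff (hx : x ∈ interior {z : Euc n | f z ≠ ∞})
    {y : Euc n} (hy : y ∈ polarSubdiff f x) :
    ∃ p ∈ subdiff f x, 0 < ⟪x, p⟫ - (f x).toReal ∧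
      y = (⟪x, p⟫ - (f x).toReal)⁻¹ • p ∧
      polarT f y = (ENNReal.ofReal (⟪x, p⟫ - (f x).toReal))⁻¹ := by
  have hxt : f x ≠ ∞ := interior_subset hx
  obtain ⟨hyt, hxy⟩ := (mem_polarSubdiff_iff hxt).1 hy
  set c := (polarT f y).toReal with hc
  have hle : ∀ z, f z ≠ ∞ → ⟪z, y⟫ ≤ 1 + c * (f z).toReal :=
    fun z hz => inner_le_one_add_polarT_mul hyt hz
  have hcpos : 0 < c := by
    refine lt_of_le_of_ne ENNReal.toReal_nonneg fun h => ?_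
    rw [← h, zero_mul] at hxy
    have hnorm : ‖y‖ ≤ (0 : NNReal) :=
      norm_le_of_subgradient_of_lipschitzOnWith (F := fun _ : Euc n => (0 : ℝ))
        (LipschitzWith.const (0 : ℝ)).lipschitzOnWith (mem_interior_iff_mem_nhds.1 hx) fun z hz => by
          have := hle z hz
          rw [← h, zero_mul] at this
          rw [inner_sub_right, real_inner_comm, real_inner_comm x y]
          linarith
    have hy0 : y = 0 := norm_le_zero_iff.1 hnorm
    rw [hy0, inner_zero_right] at hxy
    linarith
  have hl : ⟪x, c⁻¹ • y⟫ - (f x).toReal = c⁻¹ := by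
    rw [real_inner_smul_right, show ⟪x, y⟫ = 1 + c * (f x).toReal by linarith]
    field_simp
    ring
  refine ⟨c⁻¹ • y, (mem_subdiff_iff hxt).2 fun z hz => ?_, ?_, ?_, ?_⟩
  · rw [real_inner_smul_left, inner_sub_right, real_inner_comm, real_inner_comm x y]
    have h : c⁻¹ * (⟪z, y⟫ - ⟪x, y⟫) ≤ (f z).toReal - (f x).toReal := by
      rw [inv_mul_le_iff₀ hcpos]
      have := hle z hz
      linarith
    linarith
  · rw [hl]; exact inv_pos.2 hcpos
  · rw [hl, inv_inv, smul_inv_smul₀ hcpos.ne']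
  · rw [hl, ENNReal.ofReal_inv_of_pos hcpos, inv_inv, hc, ENNReal.ofReal_toReal hyt]

lemma eq_gradient_of_mem_subdiff (hx : x ∈ interior {z : Euc n | f z ≠ ∞})
    (hd : DifferentiableAt ℝ (fun z => (f z).toReal) x) {p : Euc n} (hp : p ∈ subdiff f x) :
    p = gradient (fun z => (f z).toReal) x := by
  have hmin : IsLocalMin (fun z => (f z).toReal - ⟪p, z⟫) x := by
    filter_upwards [mem_interior_iff_mem_nhds.1 hx] with z hz
    have h := (mem_subdiff_iff (interior_subset hx)).1 hp z hz
    rw [inner_sub_right] at h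
    linarith
  have h := hmin.hasFDerivAt_eq_zero (hd.hasFDerivAt.sub (innerSL ℝ p).hasFDerivAt)
  rw [sub_eq_zero] at h
  rw [gradient, h]
  exact ((InnerProductSpace.toDual ℝ (Euc n)).symm_apply_apply p).symm

/-- If the polar subdifferential at an interior point is a singleton, so is the
subdifferential. -/
lemma eq_of_mem_subdiff_of_polarSubdiff_eq_singleton (hf0 : f 0 = 0) (hx : f x ≠ ∞)
    (hfx : f x ≠ 0) {y p q : Euc n} (hy : polarSubdiff f x = {y}) (hp : p ∈ subdiff f x)
    (hppos : 0 < ⟪x, p⟫ - (f x).toReal) (hq : q ∈ subdiff f x) : q = p := by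
  have huniq : ∀ u v, u ∈ subdiff f x → v ∈ subdiff f x → 0 < ⟪x, u⟫ - (f x).toReal →
      0 < ⟪x, v⟫ - (f x).toReal → u = v := by
    intro u v hu hv hupos hvpos
    have h : (⟪x, u⟫ - (f x).toReal)⁻¹ • u = (⟪x, v⟫ - (f x).toReal)⁻¹ • v := by
      have h₁ := smul_mem_polarSubdiff hx hfx hu hupos
      have h₂ := smul_mem_polarSubdiff hx hfx hv hvpos
      rw [hy, mem_singleton_iff] at h₁ h₂
      rw [h₁, h₂]
    have hin := congrArg (fun w => ⟪x, w⟫) h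
    have hF : 0 < (f x).toReal := ENNReal.toReal_pos hfx hx
    simp only [real_inner_smul_right] at hin
    have hl : ⟪x, u⟫ - (f x).toReal = ⟪x, v⟫ - (f x).toReal := by
      rw [inv_mul_eq_div, inv_mul_eq_div, div_eq_div_iff hupos.ne' hvpos.ne'] at hin
      have : (f x).toReal * (⟪x, u⟫ - ⟪x, v⟫) = 0 := by linarith
      rcases mul_eq_zero.1 this with h0 | h0 <;> linarith
    rw [hl] at h
    exact smul_right_injective _ (inv_pos.2 hvpos).ne' h
  have hqnn := inner_sub_nonneg_of_mem_subdiff hf0 hx hq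
  set m : Euc n := (1 / 2 : ℝ) • p + (1 / 2 : ℝ) • q with hm
  have hmsub : m ∈ subdiff f x := by
    rw [mem_subdiff_iff hx] at hp hq ⊢
    intro z hz
    have h₁ := hp z hz
    have h₂ := hq z hz
    rw [hm, inner_add_left, real_inner_smul_left, real_inner_smul_left]
    linarith
  have hmpos : 0 < ⟪x, m⟫ - (f x).toReal := by
    rw [hm, inner_add_right, real_inner_smul_right, real_inner_smul_right]
    linarith
  have hmp := huniq m p hmsub hp hmpos hppos
  have : q = (2 : ℝ) • m - p := by rw [hm]; module
  rw [this, hmp]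
  module

end

/-- Lemma 3.5: relation between differentiability and polar differentiability at a point
`x ∈ int(dom f)` with `f(x) ≠ 0`. -/
theorem stmt_8 {n : ℕ} (f : Euc n → ℝ≥0∞) (hf : GeomConvexOn f) (x : Euc n)
    (hx : x ∈ interior {z : Euc n | f z ≠ ∞}) (hfx : f x ≠ 0) :
    (DifferentiableAt ℝ (fun z => (f z).toReal) x →
      polarSubdiff f x = (∅ : Set (Euc n)) ∨
      ∃ y : Euc n,
        polarSubdiff f x = {y} ∧
        y = (legendreT f (gradient (fun z => (f z).toReal) x)).toReal⁻¹
              • gradient (fun z => (f z).toReal) x ∧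
        polarT f y = (legendreT f (gradient (fun z => (f z).toReal) x))⁻¹ ∧
        (legendreT f (gradient (fun z => (f z).toReal) x) : EReal)
          = ((⟪x, gradient (fun z => (f z).toReal) x⟫ - (f x).toReal : ℝ) : EReal)) ∧
    (∀ y : Euc n, polarSubdiff f x = {y} →
      subdiff f x = {(polarT f y).toReal⁻¹ • y} ∧
      DifferentiableAt ℝ (fun z => (f z).toReal) x ∧
      y = (legendreT f (gradient (fun z => (f z).toReal) x)).toReal⁻¹
            • gradient (fun z => (f z).toReal) x) := by
  have hxt : f x ≠ ∞ := interior_subset hx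
  refine ⟨fun hd => ?_, fun y hy => ?_⟩
  · rcases (polarSubdiff f x).eq_empty_or_nonempty with h | ⟨y, hy⟩
    · exact Or.inl h
    right
    obtain ⟨p, hp, hpos, hyp, hpolar⟩ := exists_subgradient_of_mem_polarSubdiff hx hy
    have hpg := eq_gradient_of_mem_subdiff hx hd hp
    have hleg := legendreT_of_mem_subdiff hxt hp
    rw [← hpg, hleg, ENNReal.toReal_ofReal hpos.le]
    refine ⟨y, eq_singleton_iff_unique_mem.2 ⟨hy, fun y' hy' => ?_⟩, hyp, hpolar, ?_⟩
    · obtain ⟨p', hp', -, hyp', -⟩ := exists_subgradient_of_mem_polarSubdiff hx hy'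
      rw [hyp, hyp', eq_gradient_of_mem_subdiff hx hd hp', ← hpg]
    · rw [EReal.coe_ennreal_ofReal, max_eq_left hpos.le]
  · have hymem : y ∈ polarSubdiff f x := hy ▸ mem_singleton y
    obtain ⟨p, hp, hpos, hyp, hpolar⟩ := exists_subgradient_of_mem_polarSubdiff hx hymem
    have huniq : ∀ q ∈ subdiff f x, q = p := fun q hq =>
      eq_of_mem_subdiff_of_polarSubdiff_eq_singleton hf.2.2 hxt hfx hy hp hpos hq
    have hgrad : HasGradientAt (fun z => (f z).toReal) p x :=
      hf.convexOn_toReal.hasGradientAt_of_unique_subgradient hx fun q hq =>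
        huniq q ((mem_subdiff_iff hxt).2 hq)
    refine ⟨?_, hgrad.differentiableAt, ?_⟩
    · have : (polarT f y).toReal⁻¹ • y = p := by
        rw [hpolar, ENNReal.toReal_inv, inv_inv, ENNReal.toReal_ofReal hpos.le]
        conv_lhs => rw [hyp]
        rw [smul_inv_smul₀ hpos.ne']
      rw [this]
      exact eq_singleton_iff_unique_mem.2 ⟨hp, huniq⟩
    · rw [hgrad.gradient, legendreT_of_mem_subdiff hxt hp, ENNReal.toReal_ofReal hpos.le]
      exact hyp
end
end

section
/- Let f ∈ S₁(ℝⁿ). Then Pf is differentiable at every point y ≠ 0 such that Pf restricted to the segment [0,y] is not linear, and Pf is strictly convex at every such point (i.e., outside its ray-linearity zone Pf admits at each point a supporting hyperplane touching the graph only at that point). -/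
open scoped ENNReal RealInnerProductSpace
open Set

noncomputable section

section Growth

variable {E : Type*} [NormedAddCommGroup E] [NormedSpace ℝ E] [FiniteDimensional ℝ E]

/-- A continuous convex function with a strict global minimum, of value zero, grows at least
linearly away from its minimizer. -/
lemma ConvexOn.exists_mul_norm_sub_le {F : E → ℝ} (hF : ConvexOn ℝ univ F) (hc : Continuous F)
    {x₀ : E} (h₀ : F x₀ = 0) (hpos : ∀ x, x ≠ x₀ → 0 < F x) {ρ : ℝ} (hρ : 0 < ρ) :
    ∃ c : ℝ, 0 < c ∧ ∀ x, ρ ≤ ‖x - x₀‖ → c * ‖x - x₀‖ ≤ F x := by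
  obtain ⟨m, hm, hmF⟩ := (isCompact_sphere x₀ ρ).exists_forall_le' hc.continuousOn
    (a := 0) fun x hx => hpos x (by
      rintro rfl
      simp only [mem_sphere_iff_norm, sub_self, norm_zero] at hx
      exact hρ.ne hx)
  refine ⟨m / ρ, div_pos hm hρ, fun x hx => ?_⟩
  have hd : 0 < ‖x - x₀‖ := hρ.trans_le hx
  have hs1 : ρ / ‖x - x₀‖ ≤ 1 := (div_le_one hd).2 hx
  have hs0 : 0 < ρ / ‖x - x₀‖ := div_pos hρ hd
  have key := hF.2 (mem_univ x₀) (mem_univ x) (sub_nonneg.2 hs1) hs0.le (by ring)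
  have hmem : (1 - ρ / ‖x - x₀‖) • x₀ + (ρ / ‖x - x₀‖) • x ∈ Metric.sphere x₀ ρ := by
    rw [mem_sphere_iff_norm]
    have : (1 - ρ / ‖x - x₀‖) • x₀ + (ρ / ‖x - x₀‖) • x - x₀ = (ρ / ‖x - x₀‖) • (x - x₀) := by
      module
    rw [this, norm_smul, Real.norm_of_nonneg hs0.le]
    field_simp
  have h1 := (hmF _ hmem).trans key
  simp only [h₀, smul_eq_mul, mul_zero, zero_add] at h1
  rw [div_mul_eq_mul_div, div_le_iff₀ hρ]
  rw [div_mul_eq_mul_div, le_div_iff₀ hd] at h1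
  linarith

end Growth

section RealPolarity

variable {E : Type*} [NormedAddCommGroup E] [InnerProductSpace ℝ E]

/-- `p` is the (finite) polarity transform of the real-valued function `φ`: its value at `z` is the
least constant `c ≥ 0` with `⟨x,z⟩ ≤ 1 + c·φ(x)` for all `x`. -/
def IsPolarTransform (φ p : E → ℝ) : Prop :=
  ∀ z, IsLeast {c : ℝ | 0 ≤ c ∧ ∀ x, ⟪x, z⟫ ≤ 1 + c * φ x} (p z)

lemma IsPolarTransform.pos {φ p : E → ℝ} (hp : IsPolarTransform φ p) {y : E} (hy : y ≠ 0) :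
    0 < p y := by
  refine (hp y).1.1.lt_of_ne' fun h0 => ?_
  have h := (hp y).1.2 ((2 / ‖y‖ ^ 2) • y)
  have hn : 0 < ‖y‖ := norm_pos_iff.2 hy
  rw [h0, real_inner_smul_left, real_inner_self_eq_norm_sq, div_mul_cancel₀ _ (by positivity)] at h
  norm_num at h

/-- If `φ` grows at least linearly then the polarity inequality can be satisfied. -/
lemma exists_inner_le_one_add_mul [FiniteDimensional ℝ E] {φ : E → ℝ}
    (hφ : ConvexOn ℝ univ φ) (hc : Continuous φ)
    (h0 : φ 0 = 0) (hφ0 : ∀ x, 0 ≤ φ x) (hpos : ∀ x, x ≠ 0 → 0 < φ x) (z : E) :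
    ∃ c : ℝ, 0 ≤ c ∧ ∀ x, ⟪x, z⟫ ≤ 1 + c * φ x := by
  have hr : (0 : ℝ) < 1 / (‖z‖ + 1) := by positivity
  obtain ⟨m, hm, hmφ⟩ := hφ.exists_mul_norm_sub_le hc h0 hpos hr
  simp only [sub_zero] at hmφ
  refine ⟨‖z‖ / m, by positivity, fun x => (real_inner_le_norm x z).trans ?_⟩
  rcases le_total (1 / (‖z‖ + 1)) ‖x‖ with hx | hx
  · have h1 := mul_le_mul_of_nonneg_left (hmφ x hx) (show 0 ≤ ‖z‖ / m by positivity)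
    have h2 : ‖z‖ / m * (m * ‖x‖) = ‖x‖ * ‖z‖ := by field_simp
    linarith
  · rw [le_div_iff₀ (by positivity)] at hx
    have := mul_nonneg (show 0 ≤ ‖z‖ / m by positivity) (hφ0 x)
    nlinarith [norm_nonneg x]

/-- If `p` is strictly below its chord at some point of the segment `[0,y]`, then the supremum
defining the polarity transform at `y` is attained. -/
lemma IsPolarTransform.exists_eq [FiniteDimensional ℝ E] {φ p : E → ℝ} (hp : IsPolarTransform φ p)
    (hφ : ConvexOn ℝ univ φ) (hc : Continuous φ)
    (h0 : φ 0 = 0) (hφ0 : ∀ x, 0 ≤ φ x) (hpos : ∀ x, x ≠ 0 → 0 < φ x) {y : E} {t : ℝ}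
    (ht1 : t ≤ 1) (ht : p (t • y) < t * p y) : ∃ x, ⟪x, y⟫ = 1 + p y * φ x := by
  by_contra! hne
  have hlt : ∀ x, 0 < 1 + p y * φ x - ⟪x, y⟫ := fun x =>
    sub_pos.2 (((hp y).1.2 x).lt_of_ne (hne x))
  have hpt : 0 ≤ p (t • y) := (hp _).1.1
  have hpy : 0 ≤ p y := (hp _).1.1
  have ht0 : 0 < t := by
    by_contra! h
    nlinarith
  have hpy' : 0 < p y := by
    refine hpy.lt_of_ne' fun h => ?_
    rw [h] at ht
    linarith
  obtain ⟨η, hη, hηt⟩ : ∃ η, 0 < η ∧ t * p y = p (t • y) + η :=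
    ⟨t * p y - p (t • y), sub_pos.2 ht, by ring⟩
  set R : ℝ := 2 * (1 - t) / η with hR
  have hR0 : 0 ≤ R := div_nonneg (by linarith) hη.le
  have hcomp : IsCompact {x | φ x ≤ R} := by
    obtain ⟨m, hm, hmφ⟩ := hφ.exists_mul_norm_sub_le hc h0 hpos one_pos
    simp only [sub_zero] at hmφ
    refine Metric.isCompact_of_isClosed_isBounded (isClosed_le hc continuous_const) ?_
    refine (Metric.isBounded_closedBall (x := (0 : E)) (r := max 1 (R / m))).subset fun x hx => ?_
    rw [mem_closedBall_zero_iff]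
    rcases le_total 1 ‖x‖ with h | h
    · refine le_max_of_le_right ((le_div_iff₀ hm).2 ?_)
      have := (hmφ x h).trans hx
      linarith
    · exact le_max_of_le_left h
  obtain ⟨m, hm, hmψ⟩ := hcomp.exists_forall_le' (f := fun x => 1 + p y * φ x - ⟪x, y⟫)
    (by fun_prop) (a := 0) fun x _ => hlt x
  obtain ⟨δ, hδ, hδp, hδR, hδη⟩ : ∃ δ, 0 < δ ∧ δ ≤ p y ∧ δ * R ≤ m ∧ 2 * t * δ ≤ η := by
    refine ⟨min (p y) (min (m / (R + 1)) (η / (2 * t))), by positivity, min_le_left _ _, ?_, ?_⟩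
    · have h : min (p y) (min (m / (R + 1)) (η / (2 * t))) ≤ m / (R + 1) :=
        (min_le_right _ _).trans (min_le_left _ _)
      refine (mul_le_mul_of_nonneg_right h hR0).trans ?_
      rw [div_mul_eq_mul_div, div_le_iff₀ (by positivity)]
      nlinarith
    · have h : min (p y) (min (m / (R + 1)) (η / (2 * t))) ≤ η / (2 * t) :=
        (min_le_right _ _).trans (min_le_right _ _)
      rw [le_div_iff₀ (by positivity)] at h
      linarith
  have hle : p y ≤ p y - δ := (hp y).2 ⟨sub_nonneg.2 hδp, fun x => by
    rcases le_total (φ x) R with hx | hx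
    · have h1 := hmψ x hx
      have h2 := mul_le_mul_of_nonneg_left hx hδ.le
      linarith
    · have h1 := (hp (t • y)).1.2 x
      rw [real_inner_smul_right] at h1
      have h2 : 2 * (1 - t) ≤ φ x * η := by rwa [hR, div_le_iff₀ hη] at hx
      have h3 := mul_le_mul_of_nonneg_right hδη (hφ0 x)
      have h4 : t * ⟪x, y⟫ ≤ t * (1 + (p y - δ) * φ x) := by
        have : t * (1 + (p y - δ) * φ x) = t + (p (t • y) + η) * φ x - t * δ * φ x := by
          rw [← hηt]; ring
        rw [this]
        linarith
      exact le_of_mul_le_mul_left h4 ht0⟩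
  linarith

/-- The polarity transform is differentiable at `y` when the defining supremum is attained,
with gradient `x₀ / φ x₀` at the unique maximizer `x₀`. -/
lemma IsPolarTransform.hasFDerivAt [FiniteDimensional ℝ E] {φ p : E → ℝ} (hp : IsPolarTransform φ p)
    (hφ : StrictConvexOn ℝ univ φ) (hc : Continuous φ)
    (hφ0 : ∀ x, 0 ≤ φ x) {y x₀ : E} (hy : y ≠ 0) (hφx₀ : 0 < φ x₀)
    (h : ⟪x₀, y⟫ = 1 + p y * φ x₀) :
    HasFDerivAt p (innerSL ℝ ((φ x₀)⁻¹ • x₀)) y := by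
  have hpy : 0 < p y := hp.pos hy
  set g : E := (φ x₀)⁻¹ • x₀ with hg
  set ψ : E → ℝ := fun x => 1 + p y * φ x - ⟪x, y⟫ with hψ
  have hψc : Continuous ψ := by fun_prop
  have hψ0 : ∀ x, 0 ≤ ψ x := fun x => sub_nonneg.2 ((hp y).1.2 x)
  have hψconv : ConvexOn ℝ univ ψ := by
    refine ⟨convex_univ, fun u _ v _ a b ha hb hab => ?_⟩
    have h1 := mul_le_mul_of_nonneg_left
      (hφ.convexOn.2 (mem_univ u) (mem_univ v) ha hb hab) hpy.le
    simp only [hψ, inner_add_left, real_inner_smul_left, smul_eq_mul] at h1 ⊢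
    have hb' : b = 1 - a := by linarith
    subst hb'
    linarith
  have hψx₀ : ψ x₀ = 0 := by simp only [hψ, h]; ring
  have hψpos : ∀ x, x ≠ x₀ → 0 < ψ x := fun x hx => by
    refine (hψ0 x).lt_of_ne' fun hx0 => ?_
    have h1 := mul_lt_mul_of_pos_left (hφ.2 (mem_univ x) (mem_univ x₀) hx
      (show (0 : ℝ) < 1 / 2 by norm_num) (show (0 : ℝ) < 1 / 2 by norm_num) (by norm_num)) hpy
    have h2 := hψ0 ((1 / 2 : ℝ) • x + (1 / 2 : ℝ) • x₀)
    simp only [hψ, inner_add_left, real_inner_smul_left, smul_eq_mul] at h1 h2 hx0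
    linarith
  rw [hasFDerivAt_iff_isLittleO, Asymptotics.isLittleO_iff]
  intro ε hε
  -- near the maximizer
  obtain ⟨ρ, hρ, hnear⟩ : ∃ ρ > 0, ∀ x, ‖x - x₀‖ < ρ → ‖x - φ x • g‖ < ε * φ x := by
    have hev : ∀ᶠ x in nhds x₀, ‖x - φ x • g‖ < ε * φ x := by
      refine ContinuousAt.eventually_lt (by fun_prop) (by fun_prop) ?_
      rw [hg, smul_inv_smul₀ hφx₀.ne', sub_self, norm_zero]
      positivity
    obtain ⟨ρ, hρ, hb⟩ := Metric.eventually_nhds_iff.1 hev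
    exact ⟨ρ, hρ, fun x hx => hb (by rwa [dist_eq_norm])⟩
  -- away from the maximizer
  obtain ⟨C, hC, hfar⟩ : ∃ C > 0, ∀ x, ρ ≤ ‖x - x₀‖ → ‖x - φ x • g‖ ≤ C * ψ x := by
    obtain ⟨c, hc0, hcψ⟩ := hψconv.exists_mul_norm_sub_le hψc hψx₀ hψpos hρ
    set A : ℝ := (1 + ‖x₀‖ / ρ) / c with hA
    have hA0 : 0 < A := by positivity
    refine ⟨A + (1 + A * ‖y‖) / p y * ‖g‖, by positivity, fun x hx => ?_⟩
    have hxA : ‖x‖ ≤ A * ψ x := by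
      have h1 : ‖x‖ ≤ ‖x - x₀‖ + ‖x₀‖ := by simpa using norm_add_le (x - x₀) x₀
      have h2 : ‖x₀‖ ≤ ‖x₀‖ / ρ * ‖x - x₀‖ := by
        rw [div_mul_eq_mul_div, le_div_iff₀ hρ]
        exact mul_le_mul_of_nonneg_left hx (norm_nonneg _)
      have h3 : A * (c * ‖x - x₀‖) ≤ A * ψ x := mul_le_mul_of_nonneg_left (hcψ x hx) hA0.le
      have h4 : A * (c * ‖x - x₀‖) = (1 + ‖x₀‖ / ρ) * ‖x - x₀‖ := by rw [hA]; field_simp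
      linarith
    have hφA : φ x ≤ (1 + A * ‖y‖) / p y * ψ x := by
      rw [div_mul_eq_mul_div, le_div_iff₀ hpy]
      have h1 : p y * φ x = ψ x - 1 + ⟪x, y⟫ := by simp only [hψ]; ring
      have h2 := real_inner_le_norm x y
      have h3 := mul_le_mul_of_nonneg_right hxA (norm_nonneg y)
      linarith
    have h1 := norm_sub_le x (φ x • g)
    rw [norm_smul, Real.norm_of_nonneg (hφ0 x)] at h1
    have h2 := mul_le_mul_of_nonneg_right hφA (norm_nonneg g)
    linarith
  have hev : ∀ᶠ z in nhds y, ‖z - y‖ * C < 1 ∧ ‖g‖ * ‖z - y‖ < p y := by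
    refine (ContinuousAt.eventually_lt (by fun_prop) (by fun_prop) ?_).and
      (ContinuousAt.eventually_lt (by fun_prop) (by fun_prop) ?_) <;> simp [hpy]
  filter_upwards [hev] with z hz
  have hgz : ⟪g, z - y⟫ = (φ x₀)⁻¹ * ⟪x₀, z - y⟫ := real_inner_smul_left _ _ _
  have hlow : 0 ≤ p z - p y - ⟪g, z - y⟫ := by
    refine nonneg_of_mul_nonneg_right ?_ hφx₀
    have h1 := (hp z).1.2 x₀
    have h2 : φ x₀ * ⟪g, z - y⟫ = ⟪x₀, z⟫ - ⟪x₀, y⟫ := by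
      rw [hgz, mul_inv_cancel_left₀ hφx₀.ne', inner_sub_right]
    linarith
  rw [innerSL_apply_apply, Real.norm_of_nonneg hlow]
  have hup : p z ≤ p y + ⟪g, z - y⟫ + ε * ‖z - y‖ := by
    refine (hp z).2 ⟨?_, fun x => ?_⟩
    · have h1 := neg_le_of_abs_le (abs_real_inner_le_norm g (z - y))
      have h2 : 0 ≤ ε * ‖z - y‖ := by positivity
      linarith [hz.2]
    · suffices hs : ‖x - φ x • g‖ * ‖z - y‖ ≤ ψ x + ε * ‖z - y‖ * φ x by
        have h1 := real_inner_le_norm (x - φ x • g) (z - y)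
        have h2 : ⟪x - φ x • g, z - y⟫ = ⟪x, z⟫ - ⟪x, y⟫ - φ x * ⟪g, z - y⟫ := by
          rw [inner_sub_left, real_inner_smul_left, inner_sub_right x]
        have h3 : ψ x = 1 + p y * φ x - ⟪x, y⟫ := rfl
        linarith
      have hw := norm_nonneg (z - y)
      rcases lt_or_ge ‖x - x₀‖ ρ with hx | hx
      · have h1 := mul_le_mul_of_nonneg_right (hnear x hx).le hw
        linarith [hψ0 x]
      · have h1 := mul_le_mul_of_nonneg_right (hfar x hx) hw
        have h2 := mul_le_mul_of_nonneg_right hz.1.le (hψ0 x)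
        have h3 := mul_nonneg (mul_nonneg hε.le hw) (hφ0 x)
        linarith
  linarith

/-- At a maximizer `x₀` of the supremum defining the polarity transform at `y`, the vector `y` is
proportional to the gradient of `φ`. -/
lemma IsPolarTransform.mul_fderiv_eq {φ p : E → ℝ} (hp : IsPolarTransform φ p) {y x₀ : E}
    (hd : DifferentiableAt ℝ φ x₀) (h : ⟪x₀, y⟫ = 1 + p y * φ x₀) (v : E) :
    p y * fderiv ℝ φ x₀ v = ⟪v, y⟫ := by
  have hmin : IsLocalMin (fun x => p y * φ x - innerSL ℝ y x) x₀ :=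
    Filter.Eventually.of_forall fun x => by
      have := (hp y).1.2 x
      simp only [innerSL_apply_apply, real_inner_comm _ y]
      linarith
  have h1 := hmin.hasFDerivAt_eq_zero
    ((hd.hasFDerivAt.const_mul (p y)).sub (innerSL ℝ y).hasFDerivAt)
  have h2 := DFunLike.congr_fun h1 v
  simp only [sub_apply, smul_apply, smul_eq_mul,
    innerSL_apply_apply, zero_apply] at h2
  rw [real_inner_comm]
  linarith

/-- If `φ` is differentiable at `x₀`, then `x₀` attains the supremum defining the polarity transform
at no more than one point. -/
lemma IsPolarTransform.eq_of_inner_eq {φ p : E → ℝ} (hp : IsPolarTransform φ p) {y z x₀ : E}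
    (hd : DifferentiableAt ℝ φ x₀) (hy : ⟪x₀, y⟫ = 1 + p y * φ x₀)
    (hz : ⟪x₀, z⟫ = 1 + p z * φ x₀) : z = y := by
  have hDy := hp.mul_fderiv_eq hd hy
  have hDz := hp.mul_fderiv_eq hd hz
  have h1 : p y * (fderiv ℝ φ x₀ x₀ - φ x₀) = 1 := by linarith [hDy x₀]
  have h2 : p z * (fderiv ℝ φ x₀ x₀ - φ x₀) = 1 := by linarith [hDz x₀]
  have hpp : p z = p y :=
    mul_right_cancel₀ (right_ne_zero_of_mul_eq_one h1) (h2.trans h1.symm)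
  exact ext_inner_left ℝ fun v => by rw [← hDz v, ← hDy v, hpp]

end RealPolarity

/-- For finite-valued `f`, the set defining `polarT f z` is described by real inequalities. -/
lemma inner_le_one_add_ofReal_mul_iff {n : ℕ} {f : Euc n → ℝ≥0∞} (hfin : ∀ x, f x ≠ ∞) {c : ℝ}
    (hc : 0 ≤ c) (x z : Euc n) :
    ENNReal.ofReal ⟪x, z⟫ ≤ 1 + ENNReal.ofReal c * f x ↔ ⟪x, z⟫ ≤ 1 + c * (f x).toReal := by
  have h0 : 0 ≤ c * (f x).toReal := mul_nonneg hc ENNReal.toReal_nonneg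
  rw [← ENNReal.ofReal_toReal (hfin x), ← ENNReal.ofReal_mul hc, ← ENNReal.ofReal_one,
    ← ENNReal.ofReal_add zero_le_one h0, ENNReal.ofReal_le_ofReal_iff (by positivity),
    ENNReal.toReal_ofReal ENNReal.toReal_nonneg]

lemma polarT_ne_top {n : ℕ} {f : Euc n → ℝ≥0∞} (hfin : ∀ x, f x ≠ ∞) {z : Euc n}
    (h : ∃ c : ℝ, 0 ≤ c ∧ ∀ x, ⟪x, z⟫ ≤ 1 + c * (f x).toReal) : polarT f z ≠ ∞ := by
  obtain ⟨c, hc, hcx⟩ := h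
  refine ne_top_of_le_ne_top (ENNReal.ofReal_ne_top (r := c)) (sInf_le fun x => ?_)
  exact (inner_le_one_add_ofReal_mul_iff hfin hc x z).2 (hcx x)

lemma isPolarTransform_toReal {n : ℕ} {f : Euc n → ℝ≥0∞} (hfin : ∀ x, f x ≠ ∞)
    (h : ∀ z, ∃ c : ℝ, 0 ≤ c ∧ ∀ x, ⟪x, z⟫ ≤ 1 + c * (f x).toReal) :
    IsPolarTransform (fun x => (f x).toReal) (fun z => (polarT f z).toReal) := by
  intro z
  have hz := polarT_ne_top hfin (h z)
  refine ⟨⟨ENNReal.toReal_nonneg, fun x => ?_⟩, fun c ⟨hc, hcx⟩ => ?_⟩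
  · by_contra! hlt
    obtain ⟨c, hpc, hcx⟩ : ∃ c, (polarT f z).toReal < c ∧ 1 + c * (f x).toReal < ⟪x, z⟫ := by
      have hev : ∀ᶠ c in nhds (polarT f z).toReal, 1 + c * (f x).toReal < ⟪x, z⟫ :=
        ContinuousAt.eventually_lt (by fun_prop) continuousAt_const hlt
      obtain ⟨c, hc⟩ := ((hev.filter_mono nhdsWithin_le_nhds).and
        (self_mem_nhdsWithin (s := Ioi (polarT f z).toReal))).exists
      exact ⟨c, hc.2, hc.1⟩
    have hc0 : 0 ≤ c := ENNReal.toReal_nonneg.trans hpc.le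
    obtain ⟨d, hd, hdc⟩ := sInf_lt_iff.1 ((ENNReal.lt_ofReal_iff_toReal_lt hz).2 hpc)
    refine hcx.not_ge ((inner_le_one_add_ofReal_mul_iff hfin hc0 x z).1 ((hd x).trans ?_))
    gcongr
  · refine ENNReal.toReal_le_of_le_ofReal hc (sInf_le fun x => ?_)
    exact (inner_le_one_add_ofReal_mul_iff hfin hc x z).2 (hcx x)

/-- Proposition 3.6 (3)-(4): for `f ∈ S₁(ℝⁿ)`, `Pf` is differentiable and strictly convex
(admits a supporting hyperplane touching only at the point) at every `y ≠ 0` where `Pf` is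
not linear on `[0,y]`. -/
theorem stmt_10 {n : ℕ} (f : Euc n → ℝ≥0∞) (hf : S1 f) (y : Euc n) (hy : y ≠ 0)
    (hlin : ¬ RayLinear (polarT f) y) :
    DifferentiableAt ℝ (fun z => (polarT f z).toReal) y ∧
    ∃ g : Euc n, ∀ z : Euc n, z ≠ y →
      (polarT f y : EReal) + ((⟪z - y, g⟫ : ℝ) : EReal) < (polarT f z : EReal) := by
  obtain ⟨⟨-, -, hf0⟩, hfin, hdiff, hconv⟩ := hf
  have h0 : (f 0).toReal = 0 := by simp [hf0]
  have hnn : ∀ x, 0 ≤ (f x).toReal := fun x => ENNReal.toReal_nonneg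
  have hpos : ∀ x, x ≠ 0 → 0 < (f x).toReal := fun x hx => by
    have h1 := hconv.2 (mem_univ x) (mem_univ 0) hx (show (0 : ℝ) < 1 / 2 by norm_num)
      (show (0 : ℝ) < 1 / 2 by norm_num) (by norm_num)
    have h2 := hnn ((1 / 2 : ℝ) • x + (1 / 2 : ℝ) • 0)
    simp only [smul_eq_mul] at h1
    linarith
  have hcont : Continuous fun x => (f x).toReal :=
    continuousOn_univ.1 (hconv.convexOn.continuousOn isOpen_univ)
  have hex := exists_inner_le_one_add_mul hconv.convexOn hcont h0 hnn hpos
  have hp := isPolarTransform_toReal hfin hex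
  have htop : ∀ z, polarT f z ≠ ∞ := fun z => polarT_ne_top hfin (hex z)
  obtain ⟨t, ht, hlt⟩ : ∃ t : ℝ, t ≤ 1 ∧
      (polarT f (t • y)).toReal < t * (polarT f y).toReal := by
    by_contra! hge
    refine hlin ⟨(polarT f y).toReal, ENNReal.toReal_nonneg, fun t ht => ?_⟩
    have hle : (polarT f (t • y)).toReal ≤ t * (polarT f y).toReal := by
      refine (hp (t • y)).2 ⟨mul_nonneg ht.1 ENNReal.toReal_nonneg, fun x => ?_⟩
      have h1 := mul_le_mul_of_nonneg_left ((hp y).1.2 x) ht.1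
      rw [real_inner_smul_right]
      linarith [ht.2]
    rw [mul_comm, ← hle.antisymm (hge t ht.2), ENNReal.ofReal_toReal (htop _)]
  obtain ⟨x₀, hx₀⟩ := hp.exists_eq hconv.convexOn hcont h0 hnn hpos ht hlt
  have hx₀0 : x₀ ≠ 0 := by
    rintro rfl
    simp [h0] at hx₀
  have hd : DifferentiableAt ℝ (fun x => (f x).toReal) x₀ :=
    (hdiff.contDiffAt (isOpen_compl_singleton.mem_nhds hx₀0)).differentiableAt one_ne_zero
  refine ⟨(hp.hasFDerivAt hconv hcont hnn hy (hpos _ hx₀0) hx₀).differentiableAt,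
    ((f x₀).toReal)⁻¹ • x₀, fun z hz => ?_⟩
  rw [← EReal.coe_ennreal_toReal (htop y), ← EReal.coe_ennreal_toReal (htop z), ← EReal.coe_add,
    EReal.coe_lt_coe_iff]
  have hlt' := ((hp z).1.2 x₀).lt_of_ne fun h => hz (hp.eq_of_inner_eq hd hx₀ h)
  refine lt_of_mul_lt_mul_left ?_ (hnn x₀)
  have hfx := (hpos _ hx₀0).ne'
  rw [real_inner_smul_right, mul_add, mul_inv_cancel_left₀ hfx, real_inner_comm, inner_sub_right]
  linarith
end
end
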